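/- arXiv:2507.06088 — 3 statements merged into one kernel-verified Lean document; each statement's English description precedes it below -/
import Mathlib

section
/- Let d := dim H_A = dim H_{A'} and let X be a finite set with |X| ≥ d². Suppose given, for each x ∈ X, a matrix M_x on H_A ⊗ H_{A'} that is positive semidefinite with Tr_{A'} M_x = id_A and Tr_A M_x = id_{A'} (the Choi matrix of a unital channel), and positive semidefinite matrices E_y on H_{A'} ⊗ H_B ⊗ H_C for y ∈ X ∪ {∅} whose sum S := ∑_y E_y satisfies S = (1/d_C)(Tr_C S) ⊗ id_C and (1/d_C) Tr_{BC} S = id_{A'} (the tester normalization constraints). Then Θ := |X|^{-1/2} ∑_{x∈X} M_x ⋆ E_x is an entanglement retriever on H_A ⊗ H_B ⊗ H_C, where the link product over A' is defined entrywise by (M ⋆ E)_{(a,b,c),(ā,b̄,c̄)} := ∑_{a',a''} M_{(a,a''),(ā,a')} · E_{(a'',b,c),(a',b̄,c̄)}. -/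
open Matrix Kronecker BigOperators ComplexOrder

noncomputable section

/-- Partial trace over the second (right) tensor factor. -/
def ptrR {α : Type*} {n : ℕ} (M : Matrix (α × Fin n) (α × Fin n) ℂ) : Matrix α α ℂ :=
  Matrix.of fun i j => ∑ k, M (i, k) (j, k)

/-- Partial trace over the first (left) tensor factor. -/
def ptrL {m : ℕ} {β : Type*} (M : Matrix (Fin m × β) (Fin m × β) ℂ) : Matrix β β ℂ :=
  Matrix.of fun i j => ∑ k, M (k, i) (k, j)

/-- Partial trace over the last factor `C` of a matrix on `A ⊗ B ⊗ C`. -/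
def trC3 {a b c : ℕ} (M : Matrix (Fin a × Fin b × Fin c) (Fin a × Fin b × Fin c) ℂ) :
    Matrix (Fin a × Fin b) (Fin a × Fin b) ℂ :=
  Matrix.of fun x y => ∑ k, M (x.1, x.2, k) (y.1, y.2, k)

/-- Partial trace over the last two factors `B ⊗ C` of a matrix on `A ⊗ B ⊗ C`. -/
def trBC3 {a b c : ℕ} (M : Matrix (Fin a × Fin b × Fin c) (Fin a × Fin b × Fin c) ℂ) :
    Matrix (Fin a) (Fin a) ℂ :=
  Matrix.of fun i j => ∑ β : Fin b, ∑ γ : Fin c, M (i, β, γ) (j, β, γ)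

/-- Kronecker product of a matrix on `A ⊗ B` with a matrix on `C`,
yielding a matrix on `A ⊗ B ⊗ C`. -/
def kronABC {a b c : ℕ} (M : Matrix (Fin a × Fin b) (Fin a × Fin b) ℂ)
    (Y : Matrix (Fin c) (Fin c) ℂ) :
    Matrix (Fin a × Fin b × Fin c) (Fin a × Fin b × Fin c) ℂ :=
  Matrix.of fun x y => M (x.1, x.2.1) (y.1, y.2.1) * Y x.2.2 y.2.2

/-- The link product over `A'` of a matrix `M` on `H_A ⊗ H_{A'}` with a matrix `E` on
`H_{A'} ⊗ H_B ⊗ H_C`: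
`(M ⋆ E)_{(a,b,c),(ā,b̄,c̄)} = ∑_{a',a''} M_{(a,a''),(ā,a')} E_{(a'',b,c),(a',b̄,c̄)}`. -/
def linkA {a b c : ℕ} (M : Matrix (Fin a × Fin a) (Fin a × Fin a) ℂ)
    (E : Matrix (Fin a × Fin b × Fin c) (Fin a × Fin b × Fin c) ℂ) :
    Matrix (Fin a × Fin b × Fin c) (Fin a × Fin b × Fin c) ℂ :=
  Matrix.of fun x y => ∑ a' : Fin a, ∑ a'' : Fin a,
    M (x.1, a'') (y.1, a') * E (a'', x.2) (a', y.2)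

/-- An entanglement retriever: a positive semidefinite `Θ` whose partial trace over `A`
is dominated by `η ⊗ id_C` for some density matrix `η` on `H_B`. -/
def IsER {a b c : ℕ} (Θ : Matrix (Fin a × Fin b × Fin c) (Fin a × Fin b × Fin c) ℂ) : Prop :=
  Θ.PosSemidef ∧ ∃ η : Matrix (Fin b) (Fin b) ℂ, η.PosSemidef ∧ η.trace = 1 ∧
    ((η ⊗ₖ (1 : Matrix (Fin c) (Fin c) ℂ)) - ptrL Θ).PosSemidef

theorem posSemidef_ptrL {m : ℕ} {β : Type*} {M : Matrix (Fin m × β) (Fin m × β) ℂ}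
    (hM : M.PosSemidef) : (ptrL M).PosSemidef := by
  have h : ptrL M = ∑ k, M.submatrix (fun i => (k, i)) (fun i => (k, i)) := by
    ext i j
    simp [ptrL, Matrix.sum_apply]
  rw [h]
  exact Matrix.posSemidef_sum _ fun k _ => hM.submatrix _

theorem posSemidef_trC3 {a b c : ℕ}
    {M : Matrix (Fin a × Fin b × Fin c) (Fin a × Fin b × Fin c) ℂ}
    (hM : M.PosSemidef) : (trC3 M).PosSemidef := by
  have h : trC3 M = ∑ k, M.submatrix (fun x : Fin a × Fin b => (x.1, x.2, k))
      (fun x : Fin a × Fin b => (x.1, x.2, k)) := by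
    ext i j
    simp [trC3, Matrix.sum_apply]
  rw [h]
  exact Matrix.posSemidef_sum _ fun k _ => hM.submatrix _

/-- Summing all blocks of a positive semidefinite block matrix keeps it positive semidefinite. -/
theorem posSemidef_sum_blocks {α ι : Type*} [Fintype α] [Fintype ι] [DecidableEq α]
    {K : Matrix (α × ι) (α × ι) ℂ} (hK : K.PosSemidef) :
    (Matrix.of fun x y => ∑ q, ∑ p, K (x, p) (y, q) : Matrix α α ℂ).PosSemidef := by
  let W : Matrix α (α × ι) ℂ := Matrix.of fun x y => if x = y.1 then 1 else 0
  convert hK.mul_mul_conjTranspose_same W using 1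
  ext x y
  have h (z : α × ι) : (W * K) x z = ∑ p, K (x, p) z := by
    rw [Matrix.mul_apply, Fintype.sum_prod_type, Finset.sum_eq_single x]
    · simp [W]
    · intro b _ hb
      simp [W, hb.symm]
    · simp
  rw [Matrix.mul_apply, Fintype.sum_prod_type, Finset.sum_eq_single y]
  · simp [W, h]
  · intro b _ hb
    simp [W, hb.symm]
  · simp

theorem posSemidef_linkA {a b c : ℕ} {M : Matrix (Fin a × Fin a) (Fin a × Fin a) ℂ}
    {E : Matrix (Fin a × Fin b × Fin c) (Fin a × Fin b × Fin c) ℂ}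
    (hM : M.PosSemidef) (hE : E.PosSemidef) : (linkA M E).PosSemidef := by
  have h := posSemidef_sum_blocks ((hM.kronecker hE).submatrix
    fun z : (Fin a × Fin b × Fin c) × Fin a => ((z.1.1, z.2), (z.2, z.1.2)))
  simpa only [linkA, Matrix.submatrix_apply, Matrix.kroneckerMap_apply] using h

theorem ptrL_add {m : ℕ} {β : Type*} (M N : Matrix (Fin m × β) (Fin m × β) ℂ) :
    ptrL (M + N) = ptrL M + ptrL N := by
  ext i j
  simp [ptrL, Finset.sum_add_distrib]

theorem ptrL_smul {m : ℕ} {β : Type*} (r : ℂ) (M : Matrix (Fin m × β) (Fin m × β) ℂ) :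
    ptrL (r • M) = r • ptrL M := by
  ext i j
  simp [ptrL, Finset.mul_sum]

theorem ptrL_sum {m : ℕ} {β ι : Type*} (s : Finset ι)
    (M : ι → Matrix (Fin m × β) (Fin m × β) ℂ) :
    ptrL (∑ x ∈ s, M x) = ∑ x ∈ s, ptrL (M x) := by
  ext i j
  simp only [ptrL, Matrix.of_apply, Matrix.sum_apply]
  exact Finset.sum_comm

/-- Linking with a trace-preserving Choi matrix does not change the partial trace. -/
theorem ptrL_linkA {a b c : ℕ} {M : Matrix (Fin a × Fin a) (Fin a × Fin a) ℂ}
    (E : Matrix (Fin a × Fin b × Fin c) (Fin a × Fin b × Fin c) ℂ) (hM : ptrL M = 1) :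
    ptrL (linkA M E) = ptrL E := by
  ext i j
  have h (p q : Fin a) : ∑ k, M (k, p) (k, q) = if p = q then 1 else 0 := by
    have := congrFun (congrFun hM p) q
    simpa [ptrL, Matrix.one_apply] using this
  simp only [ptrL, linkA, Matrix.of_apply]
  rw [Finset.sum_comm]
  refine Finset.sum_congr rfl fun q _ => ?_
  rw [Finset.sum_comm]
  simp [← Finset.sum_mul, h]

theorem ptrL_kronABC_one {a b c : ℕ} (M : Matrix (Fin a × Fin b) (Fin a × Fin b) ℂ) :
    ptrL (kronABC M (1 : Matrix (Fin c) (Fin c) ℂ)) = ptrL M ⊗ₖ 1 := by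
  ext i j
  simp [ptrL, kronABC, Matrix.kroneckerMap_apply, Finset.sum_mul]

theorem trace_ptrL_trC3 {a b c : ℕ}
    (M : Matrix (Fin a × Fin b × Fin c) (Fin a × Fin b × Fin c) ℂ) :
    (ptrL (trC3 M)).trace = (trBC3 M).trace := by
  simp only [Matrix.trace, Matrix.diag, ptrL, trC3, trBC3, Matrix.of_apply]
  exact Finset.sum_comm

/-- **Observation 3, converse direction.** The operator assembled from any
encoding-decoding strategy (unital-channel Choi matrices `M_x` and a tester `(E_y)`) is an
entanglement retriever. -/
theorem stmt7 (d dB dC n : ℕ) (hd : 0 < d) (hn : d ^ 2 ≤ n)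
    (M : Fin n → Matrix (Fin d × Fin d) (Fin d × Fin d) ℂ)
    (hM : ∀ x, (M x).PosSemidef ∧ ptrR (M x) = 1 ∧ ptrL (M x) = 1)
    (E : Option (Fin n) → Matrix (Fin d × Fin dB × Fin dC) (Fin d × Fin dB × Fin dC) ℂ)
    (hE : ∀ y, (E y).PosSemidef)
    (hS1 : (∑ y, E y) =
      ((dC : ℂ))⁻¹ • kronABC (trC3 (∑ y, E y)) (1 : Matrix (Fin dC) (Fin dC) ℂ))
    (hS2 : ((dC : ℂ))⁻¹ • trBC3 (∑ y, E y) = 1) :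
    IsER (((Real.sqrt n : ℝ) : ℂ)⁻¹ • ∑ x : Fin n, linkA (M x) (E (some x))) := by
  have hsqrt : (0 : ℂ) ≤ ((Real.sqrt n : ℝ) : ℂ)⁻¹ := by
    rw [← Complex.ofReal_inv]
    exact Complex.zero_le_real.2 (by positivity)
  have hnat (m : ℕ) : (0 : ℂ) ≤ ((m : ℂ))⁻¹ := by
    rw [← Complex.ofReal_natCast, ← Complex.ofReal_inv]
    exact Complex.zero_le_real.2 (by positivity)
  have hle : (0 : ℂ) ≤ (d : ℂ)⁻¹ - ((Real.sqrt n : ℝ) : ℂ)⁻¹ := by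
    rw [← Complex.ofReal_natCast, ← Complex.ofReal_inv, ← Complex.ofReal_inv,
      ← Complex.ofReal_sub]
    refine Complex.zero_le_real.2 (sub_nonneg.2 ?_)
    have : (d : ℝ) ≤ Real.sqrt n := Real.le_sqrt_of_sq_le (by exact_mod_cast hn)
    gcongr
  have hS : (∑ y, E y).PosSemidef := Matrix.posSemidef_sum _ fun y _ => hE y
  refine ⟨(Matrix.posSemidef_sum _ fun x _ => posSemidef_linkA (hM x).1 (hE _)).smul hsqrt,
    (d : ℂ)⁻¹ • (dC : ℂ)⁻¹ • ptrL (trC3 (∑ y, E y)),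
    ((posSemidef_ptrL (posSemidef_trC3 hS)).smul (hnat dC)).smul (hnat d), ?_, ?_⟩
  · have htr := congrArg Matrix.trace hS2
    rw [Matrix.trace_smul, ← trace_ptrL_trC3, Matrix.trace_one, Fintype.card_fin] at htr
    rw [Matrix.trace_smul, Matrix.trace_smul, htr, smul_eq_mul]
    exact inv_mul_cancel₀ (by exact_mod_cast hd.ne')
  · have hkron : ((d : ℂ)⁻¹ • (dC : ℂ)⁻¹ • ptrL (trC3 (∑ y, E y))) ⊗ₖ
        (1 : Matrix (Fin dC) (Fin dC) ℂ) = (d : ℂ)⁻¹ • ptrL (∑ y, E y) := by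
      rw [Matrix.smul_kronecker, Matrix.smul_kronecker, ← ptrL_kronABC_one, ← ptrL_smul, ← hS1]
    have hΘ : ptrL (∑ x, linkA (M x) (E (some x))) = ptrL (∑ y, E y) - ptrL (E none) := by
      rw [Fintype.sum_option, ptrL_add, add_sub_cancel_left, ptrL_sum, ptrL_sum]
      exact Finset.sum_congr rfl fun x _ => ptrL_linkA _ (hM x).2.2
    rw [hkron, ptrL_smul, hΘ]
    convert ((posSemidef_ptrL hS).smul hle).add ((posSemidef_ptrL (hE none)).smul hsqrt) using 1
    rw [sub_smul, smul_sub]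
    abel
end
end

section
/- Let W be a matrix on H_A ⊗ H_B ⊗ H_C with classical memory, and let Θ be an entanglement retriever on H_A ⊗ H_B ⊗ H_C. Then Tr(Θ W) is a real number and Tr(Θ W) ≤ 1. -/
open Matrix Kronecker BigOperators ComplexOrder

noncomputable section

/-- A matrix on `H_A ⊗ H_B ⊗ H_C` has classical memory if it is a convex combination of
products `ρ_λ ⊗ N_λ` of density matrices with Choi matrices of channels. -/
def ClassicalMemory {a b c : ℕ}
    (W : Matrix (Fin a × Fin b × Fin c) (Fin a × Fin b × Fin c) ℂ) : Prop :=
  ∃ (k : ℕ) (p : Fin k → ℝ) (ρ : Fin k → Matrix (Fin a) (Fin a) ℂ)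
    (N : Fin k → Matrix (Fin b × Fin c) (Fin b × Fin c) ℂ),
    (∀ l, 0 ≤ p l) ∧ (∑ l, p l) = 1 ∧
    (∀ l, (ρ l).PosSemidef ∧ (ρ l).trace = 1) ∧
    (∀ l, (N l).PosSemidef ∧ ptrR (N l) = 1) ∧
    W = ∑ l, (p l : ℂ) • ((ρ l) ⊗ₖ (N l))

/-- The trace of a product of two positive semidefinite matrices is nonnegative. -/
lemma trace_mul_nonneg_of_posSemidef {n : Type*} [Fintype n] {A B : Matrix n n ℂ}
    (hA : A.PosSemidef) (hB : B.PosSemidef) : 0 ≤ (A * B).trace := by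
  classical
  open scoped MatrixOrder in
  obtain ⟨C, rfl⟩ := CStarAlgebra.nonneg_iff_eq_star_mul_self.mp hB.nonneg
  rw [← Matrix.mul_assoc, Matrix.trace_mul_comm, ← Matrix.mul_assoc]
  exact (hA.mul_mul_conjTranspose_same C).trace_nonneg

/-- A density matrix is dominated by the identity. -/
lemma posSemidef_one_sub_of_trace_eq_one {n : Type*} [Fintype n] [DecidableEq n]
    {A : Matrix n n ℂ} (hA : A.PosSemidef) (htr : A.trace = 1) : (1 - A).PosSemidef := by
  have hle (i : n) : hA.1.eigenvalues i ≤ 1 := by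
    have hsum : ∑ j, hA.1.eigenvalues j = 1 := by
      have h := hA.1.trace_eq_sum_eigenvalues
      rw [htr] at h
      simpa using congrArg Complex.re h.symm
    rw [← hsum]
    exact Finset.single_le_sum (fun j _ => hA.eigenvalues_nonneg j) (Finset.mem_univ i)
  have hspec := hA.1.spectral_theorem
  rw [Unitary.conjStarAlgAut_apply] at hspec
  have hU : (hA.1.eigenvectorUnitary : Matrix n n ℂ) * star (hA.1.eigenvectorUnitary : Matrix n n ℂ)
      = 1 := Unitary.coe_mul_star_self _
  have hD : (1 - diagonal (RCLike.ofReal ∘ hA.1.eigenvalues) : Matrix n n ℂ).PosSemidef := by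
    rw [← diagonal_one, diagonal_sub]
    refine PosSemidef.diagonal fun i => ?_
    simpa using Complex.real_le_real.mpr (hle i)
  have h := hD.mul_mul_conjTranspose_same (hA.1.eigenvectorUnitary : Matrix n n ℂ)
  rwa [← star_eq_conjTranspose, Matrix.mul_sub, Matrix.sub_mul, Matrix.mul_one, hU, ← hspec] at h

lemma trace_mul_one_kronecker {m : ℕ} {β : Type*} [Fintype β]
    (Θ : Matrix (Fin m × β) (Fin m × β) ℂ) (N : Matrix β β ℂ) :
    (Θ * ((1 : Matrix (Fin m) (Fin m) ℂ) ⊗ₖ N)).trace = (ptrL Θ * N).trace := by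
  simp only [trace, diag_apply, mul_apply, kroneckerMap_apply, one_apply, Fintype.sum_prod_type,
    ptrL, of_apply, Finset.sum_mul, ite_mul, one_mul, zero_mul, mul_ite, mul_zero]
  rw [Finset.sum_comm]
  refine Finset.sum_congr rfl fun i _ => ?_
  rw [Finset.sum_comm]
  simp [Finset.sum_comm (s := (Finset.univ : Finset β))]

lemma trace_kronecker_one_mul {α : Type*} [Fintype α] {n : ℕ}
    (η : Matrix α α ℂ) (N : Matrix (α × Fin n) (α × Fin n) ℂ) :
    ((η ⊗ₖ (1 : Matrix (Fin n) (Fin n) ℂ)) * N).trace = (η * ptrR N).trace := by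
  simp only [trace, diag_apply, mul_apply, kroneckerMap_apply, one_apply, Fintype.sum_prod_type,
    ptrR, of_apply, Finset.mul_sum, ite_mul, mul_one, zero_mul, mul_ite, mul_zero]
  refine Finset.sum_congr rfl fun i _ => ?_
  rw [Finset.sum_comm]
  simp

/-- An entanglement retriever takes values in `[0, 1]` on products of a density matrix with the
Choi matrix of a channel. -/
lemma IsER.trace_mul_kronecker_mem {a b c : ℕ}
    {Θ : Matrix (Fin a × Fin b × Fin c) (Fin a × Fin b × Fin c) ℂ} (hΘ : IsER Θ)
    {ρ : Matrix (Fin a) (Fin a) ℂ} (hρ : ρ.PosSemidef) (hρtr : ρ.trace = 1)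
    {N : Matrix (Fin b × Fin c) (Fin b × Fin c) ℂ} (hN : N.PosSemidef) (hNtr : ptrR N = 1) :
    0 ≤ (Θ * (ρ ⊗ₖ N)).trace ∧ (Θ * (ρ ⊗ₖ N)).trace ≤ 1 := by
  obtain ⟨hpos, η, -, hηtr, hdom⟩ := hΘ
  refine ⟨trace_mul_nonneg_of_posSemidef hpos (hρ.kronecker hN), ?_⟩
  have h₁ := trace_mul_nonneg_of_posSemidef hpos
    ((posSemidef_one_sub_of_trace_eq_one hρ hρtr).kronecker hN)
  have hsub : ((1 - ρ) ⊗ₖ N) = (1 : Matrix (Fin a) (Fin a) ℂ) ⊗ₖ N - ρ ⊗ₖ N := by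
    ext; simp [sub_mul]
  rw [hsub, Matrix.mul_sub, trace_sub, trace_mul_one_kronecker, sub_nonneg] at h₁
  have h₂ := trace_mul_nonneg_of_posSemidef hdom hN
  rw [Matrix.sub_mul, trace_sub, trace_kronecker_one_mul, hNtr, Matrix.mul_one, hηtr,
    sub_nonneg] at h₂
  exact h₁.trans h₂

/-- **Observation 2, first part.** For a classical-memory process `W` and an
entanglement retriever `Θ`, `Tr(Θ W)` is real and at most `1`. -/
theorem stmt9 (dA dB dC : ℕ)
    (W Θ : Matrix (Fin dA × Fin dB × Fin dC) (Fin dA × Fin dB × Fin dC) ℂ)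
    (hW : ClassicalMemory W) (hΘ : IsER Θ) :
    ((Θ * W).trace).im = 0 ∧ ((Θ * W).trace).re ≤ 1 := by
  obtain ⟨k, p, ρ, N, hp, hsum, hρ, hN, rfl⟩ := hW
  have hmem (l : Fin k) := hΘ.trace_mul_kronecker_mem (hρ l).1 (hρ l).2 (hN l).1 (hN l).2
  have htr : (Θ * ∑ l, (p l : ℂ) • (ρ l ⊗ₖ N l)).trace
      = ∑ l, (p l : ℂ) * (Θ * (ρ l ⊗ₖ N l)).trace := by
    simp [Matrix.mul_sum, trace_sum, trace_smul]
  have hp' (l : Fin k) : (0 : ℂ) ≤ p l := by exact_mod_cast hp l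
  have hle : (Θ * ∑ l, (p l : ℂ) • (ρ l ⊗ₖ N l)).trace ≤ 1 := by
    calc
      _ = ∑ l, (p l : ℂ) * (Θ * (ρ l ⊗ₖ N l)).trace := htr
      _ ≤ ∑ l, (p l : ℂ) := Finset.sum_le_sum fun l _ =>
        mul_le_of_le_one_right (hp' l) (hmem l).2
      _ = 1 := by exact_mod_cast hsum
  obtain ⟨hre, him⟩ := Complex.le_def.mp hle
  exact ⟨by simpa using him, by simpa using hre⟩
end
end

section
/- Let n be a natural number, g, Δ : Fin n → ℝ, and let q : ℝ → ℂ and α_k : ℝ → ℂ (for k ∈ Fin n) be differentiable functions such that α_k(0) = 0, α_k'(t) = −i·g_k·exp(i·Δ_k·t)·q(t) for all t, and q'(t) = −i·∑_k g_k·exp(−i·Δ_k·t)·α_k(t) for all t. Then for every real t: q'(t) = −∫₀^t f(t − s)·q(s) ds, where f(u) := ∑_k g_k²·exp(−i·Δ_k·u). -/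
open Complex BigOperators

/-- In the single-excitation sector of the spin-boson model with finitely
many bath modes, the coupled Schrödinger amplitude equations reduce to the memory-kernel
equation `q̇(t) = −∫₀^t f(t−s) q(s) ds` with `f(u) = ∑_k g_k² e^{−i Δ_k u}`. -/
theorem stmt18 (n : ℕ) (g Δ : Fin n → ℝ) (q : ℝ → ℂ) (α : Fin n → ℝ → ℂ)
    (hq : Differentiable ℝ q) (hα : ∀ k, Differentiable ℝ (α k))
    (hα0 : ∀ k, α k 0 = 0)
    (hα' : ∀ k t, deriv (α k) t =
      -Complex.I * (g k : ℂ) * Complex.exp (Complex.I * (Δ k : ℂ) * (t : ℂ)) * q t)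
    (hq' : ∀ t, deriv q t =
      -Complex.I * ∑ k, (g k : ℂ) * Complex.exp (-Complex.I * (Δ k : ℂ) * (t : ℂ)) * α k t) :
    ∀ t : ℝ, deriv q t =
      -∫ s in (0 : ℝ)..t,
        (∑ k, (g k : ℂ) ^ 2 * Complex.exp (-Complex.I * (Δ k : ℂ) * ((t : ℂ) - (s : ℂ)))) *
          q s := by
  intro t
  have hcont : ∀ k, Continuous fun s : ℝ =>
      Complex.exp (Complex.I * (Δ k : ℂ) * (s : ℂ)) * q s := fun k =>
    Continuous.mul (by fun_prop) hq.continuous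
  have hαt : ∀ k, α k t = -Complex.I * (g k : ℂ) *
      ∫ s in (0 : ℝ)..t, Complex.exp (Complex.I * (Δ k : ℂ) * (s : ℂ)) * q s := by
    intro k
    have hderiv : deriv (α k) = fun s : ℝ => -Complex.I * (g k : ℂ) *
        (Complex.exp (Complex.I * (Δ k : ℂ) * (s : ℂ)) * q s) := by
      funext s
      rw [hα' k s, mul_assoc]
    have hint : IntervalIntegrable (deriv (α k)) MeasureTheory.volume 0 t := by
      rw [hderiv]
      exact ((hcont k).const_mul _).intervalIntegrable 0 t
    have hftc := intervalIntegral.integral_deriv_eq_sub (fun s _ => hα k s) hint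
    rw [hα0 k, sub_zero, hderiv, intervalIntegral.integral_const_mul] at hftc
    exact hftc.symm
  have hkernel : ∀ s : ℝ,
      (∑ k, (g k : ℂ) ^ 2 * Complex.exp (-Complex.I * (Δ k : ℂ) * ((t : ℂ) - (s : ℂ)))) * q s =
        ∑ k, (g k : ℂ) ^ 2 * Complex.exp (-Complex.I * (Δ k : ℂ) * (t : ℂ)) *
          (Complex.exp (Complex.I * (Δ k : ℂ) * (s : ℂ)) * q s) := by
    intro s
    rw [Finset.sum_mul]
    refine Finset.sum_congr rfl fun k _ => ?_
    rw [show -Complex.I * (Δ k : ℂ) * ((t : ℂ) - (s : ℂ)) =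
      -Complex.I * (Δ k : ℂ) * (t : ℂ) + Complex.I * (Δ k : ℂ) * (s : ℂ) by ring, Complex.exp_add]
    ring
  simp_rw [hkernel]
  rw [hq' t, intervalIntegral.integral_finsetSum fun k _ =>
    ((hcont k).const_mul _).intervalIntegrable 0 t, Finset.mul_sum, ← Finset.sum_neg_distrib]
  refine Finset.sum_congr rfl fun k _ => ?_
  rw [hαt k, intervalIntegral.integral_const_mul]
  linear_combination (g k : ℂ) ^ 2 * Complex.exp (-Complex.I * (Δ k : ℂ) * (t : ℂ)) *
    (∫ s in (0 : ℝ)..t, Complex.exp (Complex.I * (Δ k : ℂ) * (s : ℂ)) * q s) * Complex.I_sq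
end
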